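/- arXiv:1612.07663 — 4 statements merged into one kernel-verified Lean document; each statement's English description precedes it below -/
import Mathlib

section
/- Let Γ be a finite abelian group (written additively), and let φ : A → B be a homomorphism of commutative rings each equipped with a Γ-grading, such that φ(A_g) ⊆ B_g for every g ∈ Γ. Assume that for every g ∈ Γ there exists an element a_g ∈ A_g that is a unit of A. Then: (i) for all i, j ∈ Γ the multiplication map B_i ⊗_{B_0} B_j → B_{i+j} is bijective; (ii) for every g ∈ Γ the map A_g ⊗_{A_0} B_0 → B_g sending a ⊗ b to φ(a)·b is bijective; (iii) the map A ⊗_{A_0} B_0 → B sending a ⊗ b to φ(a)·b is bijective. (Here A_0 is a subring of A, B_0 is a subring of B, each A_g is an A_0-module and each B_g is a B_0-module via multiplication.) -/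
open scoped TensorProduct

set_option synthInstance.maxHeartbeats 400000
set_option maxHeartbeats 1000000

section GradedPieces

variable {ι : Type*} [AddCommGroup ι] [DecidableEq ι]
variable {A : Type*} [CommRing A]

/-- The action of the degree-zero part `𝒜 0` on the degree-`i` part `𝒜 i` by multiplication. -/
instance gradeZeroSMulPiece (𝒜 : ι → AddSubgroup A) [GradedRing 𝒜] (i : ι) :
    SMul ↥(𝒜 0) ↥(𝒜 i) :=
  ⟨fun c x => ⟨(c : A) * (x : A), by simpa using SetLike.mul_mem_graded c.2 x.2⟩⟩

/-- Each graded piece `𝒜 i` is a module over the degree-zero subring `𝒜 0`. -/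
instance gradeZeroModulePiece (𝒜 : ι → AddSubgroup A) [GradedRing 𝒜] (i : ι) :
    Module ↥(𝒜 0) ↥(𝒜 i) where
  one_smul x := Subtype.ext (one_mul (x : A))
  mul_smul c d x := Subtype.ext (mul_assoc (c : A) d x)
  smul_zero c := Subtype.ext (mul_zero (c : A))
  smul_add c x y := Subtype.ext (mul_add (c : A) x y)
  add_smul c d x := Subtype.ext (add_mul (c : A) d x)
  zero_smul x := Subtype.ext (zero_mul (x : A))

/-- The multiplication map `𝒜 i ⊗_{𝒜 0} 𝒜 j → 𝒜 (i + j)` induced by the multiplication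
of the graded ring `A`. -/
noncomputable def gradedMulMap (𝒜 : ι → AddSubgroup A) [GradedRing 𝒜] (i j : ι) :
    (↥(𝒜 i) ⊗[↥(𝒜 0)] ↥(𝒜 j)) →+ ↥(𝒜 (i + j)) :=
  TensorProduct.liftAddHom
    { toFun := fun x =>
        { toFun := fun y => ⟨(x : A) * (y : A), SetLike.mul_mem_graded x.2 y.2⟩
          map_zero' := Subtype.ext (mul_zero (x : A))
          map_add' := fun y z => Subtype.ext (mul_add (x : A) y z) }
      map_zero' := AddMonoidHom.ext fun y => Subtype.ext (zero_mul (y : A))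
      map_add' := fun x x' => AddMonoidHom.ext fun y => Subtype.ext (add_mul (x : A) x' y) }
    (fun c x y =>
      Subtype.ext ((mul_assoc (c : A) x y).trans (mul_left_comm (c : A) x y)))

/-- The inclusion of the degree-zero subring `𝒜 0` into `A`. -/
def gradeZeroInclusion (𝒜 : ι → AddSubgroup A) [GradedRing 𝒜] : ↥(𝒜 0) →+* A where
  toFun := Subtype.val
  map_one' := rfl
  map_mul' _ _ := rfl
  map_zero' := rfl
  map_add' _ _ := rfl

/-- `A` is a module over its degree-zero subring `𝒜 0`. -/
instance gradeZeroModuleAmbient (𝒜 : ι → AddSubgroup A) [GradedRing 𝒜] :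
    Module ↥(𝒜 0) A :=
  Module.compHom A (gradeZeroInclusion 𝒜)

end GradedPieces

section Transfer

variable {ι : Type*} [AddCommGroup ι] [DecidableEq ι]
variable {A B : Type*} [CommRing A] [CommRing B]
variable (𝒜 : ι → AddSubgroup A) (ℬ : ι → AddSubgroup B) [GradedRing 𝒜] [GradedRing ℬ]
variable (φ : A →+* B)

/-- The restriction of a graded ring homomorphism `φ : A → B` to the degree-zero subrings. -/
def gradeZeroMap (hφ : ∀ (g : ι) (a : A), a ∈ 𝒜 g → φ a ∈ ℬ g) : ↥(𝒜 0) →+* ↥(ℬ 0) where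
  toFun c := ⟨φ (c : A), hφ 0 c c.2⟩
  map_one' := Subtype.ext (map_one φ)
  map_mul' c d := Subtype.ext (map_mul φ (c : A) (d : A))
  map_zero' := Subtype.ext (map_zero φ)
  map_add' c d := Subtype.ext (map_add φ (c : A) (d : A))

/-- `ℬ 0` is a module over `𝒜 0` via `φ`. -/
def moduleB0 (hφ : ∀ (g : ι) (a : A), a ∈ 𝒜 g → φ a ∈ ℬ g) : Module ↥(𝒜 0) ↥(ℬ 0) :=
  Module.compHom _ (gradeZeroMap 𝒜 ℬ φ hφ)

/-- The map `𝒜 g ⊗_{𝒜 0} ℬ 0 → ℬ g` sending `a ⊗ b` to `φ(a)·b`. -/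
noncomputable def transferPiece (hφ : ∀ (g : ι) (a : A), a ∈ 𝒜 g → φ a ∈ ℬ g) (g : ι) :
    letI := moduleB0 𝒜 ℬ φ hφ
    (↥(𝒜 g) ⊗[↥(𝒜 0)] ↥(ℬ 0)) →+ ↥(ℬ g) :=
  letI := moduleB0 𝒜 ℬ φ hφ
  TensorProduct.liftAddHom
    { toFun := fun a =>
        { toFun := fun b =>
            ⟨φ (a : A) * (b : B), by simpa using SetLike.mul_mem_graded (hφ g a a.2) b.2⟩
          map_zero' := Subtype.ext (mul_zero _)
          map_add' := fun b b' => Subtype.ext (mul_add _ (b : B) (b' : B)) }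
      map_zero' := AddMonoidHom.ext fun b => Subtype.ext (by simp)
      map_add' := fun a a' => AddMonoidHom.ext fun b => Subtype.ext (by simp [add_mul]) }
    (fun c a b => Subtype.ext (by
      show φ ((c : A) * (a : A)) * (b : B) = φ (a : A) * (φ (c : A) * (b : B))
      rw [map_mul]; ring))

/-- The map `A ⊗_{A_0} ℬ 0 → B` sending `a ⊗ b` to `φ(a)·b`. -/
noncomputable def transferTotal (hφ : ∀ (g : ι) (a : A), a ∈ 𝒜 g → φ a ∈ ℬ g) :
    letI := moduleB0 𝒜 ℬ φ hφ
    (A ⊗[↥(𝒜 0)] ↥(ℬ 0)) →+ B :=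
  letI := moduleB0 𝒜 ℬ φ hφ
  TensorProduct.liftAddHom
    { toFun := fun a =>
        { toFun := fun b => φ a * (b : B)
          map_zero' := mul_zero _
          map_add' := fun b b' => mul_add _ (b : B) (b' : B) }
      map_zero' := AddMonoidHom.ext fun b => by simp
      map_add' := fun a a' => AddMonoidHom.ext fun b => by simp [add_mul] }
    (fun c a b => by
      show φ ((c : A) * a) * (b : B) = φ a * (φ (c : A) * (b : B))
      rw [map_mul]; ring)

end Transfer

/-- If `u` generates `M`, then every element of `M ⊗ N` has the form `u ⊗ y`. -/
theorem TensorProduct.exists_eq_tmul_of_forall_eq_smul {R M N : Type*} [CommSemiring R]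
    [AddCommMonoid M] [AddCommMonoid N] [Module R M] [Module R N] {u : M}
    (hu : ∀ x : M, ∃ c : R, x = c • u) (t : M ⊗[R] N) : ∃ y : N, t = u ⊗ₜ y := by
  induction t with
  | zero => exact ⟨0, (TensorProduct.tmul_zero _ _).symm⟩
  | tmul x y =>
    obtain ⟨c, rfl⟩ := hu x
    exact ⟨c • y, TensorProduct.smul_tmul _ _ _⟩
  | add s t hs ht =>
    obtain ⟨y, rfl⟩ := hs
    obtain ⟨z, rfl⟩ := ht
    exact ⟨y + z, (TensorProduct.tmul_add _ _ _).symm⟩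

section HomogeneousUnits

variable {ι : Type*} [AddCommGroup ι] [DecidableEq ι]
variable {A B : Type*} [CommRing A] [CommRing B]
variable (𝒜 : ι → AddSubgroup A) (ℬ : ι → AddSubgroup B) [GradedRing 𝒜] [GradedRing ℬ]

/-- The inverse of a homogeneous unit of degree `g` is homogeneous of degree `-g`. -/
theorem exists_homogeneous_inverse {g : ι} {a : A} (ha : a ∈ 𝒜 g) (hu : IsUnit a) :
    ∃ b ∈ 𝒜 (-g), a * b = 1 := by
  obtain ⟨c, hc⟩ := hu.exists_right_inv
  refine ⟨DirectSum.decompose 𝒜 c (-g), SetLike.coe_mem _, ?_⟩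
  rw [← DirectSum.coe_decompose_mul_add_of_left_mem 𝒜 ha, hc, add_neg_cancel,
    DirectSum.decompose_of_mem_same 𝒜 SetLike.GradedOne.one_mem]

/-- If `v` is an inverse of degree `-i` of a homogeneous `u` of degree `i`, then `u` generates
the degree-`i` part over the degree-zero part. -/
theorem exists_gradeZero_smul_eq {i : ι} (u : 𝒜 i) {v : A} (hv : v ∈ 𝒜 (-i))
    (huv : (u : A) * v = 1) (x : 𝒜 i) : ∃ c : 𝒜 0, x = c • u := by
  refine ⟨⟨x * v, by simpa using SetLike.mul_mem_graded x.2 hv⟩, Subtype.ext ?_⟩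
  change (x : A) = x * v * u
  linear_combination (-(x : A)) * huv

/-- Multiplication `𝒜 i ⊗ 𝒜 j → 𝒜 (i + j)` is bijective if `𝒜 i` contains a unit. -/
theorem gradedMulMap_bijective {i : ι} {u : A} (hu : u ∈ 𝒜 i) (hunit : IsUnit u) (j : ι) :
    Function.Bijective (gradedMulMap 𝒜 i j) := by
  obtain ⟨v, hv, huv⟩ := exists_homogeneous_inverse 𝒜 hu hunit
  constructor
  · rw [injective_iff_map_eq_zero]
    intro t ht
    obtain ⟨y, rfl⟩ := TensorProduct.exists_eq_tmul_of_forall_eq_smul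
      (exists_gradeZero_smul_eq 𝒜 ⟨u, hu⟩ hv huv) t
    have hy : u * (y : A) = 0 := congrArg Subtype.val ht
    have : y = 0 := Subtype.ext (hunit.mul_right_eq_zero.mp hy)
    rw [this, TensorProduct.tmul_zero]
  · intro b
    refine ⟨(⟨u, hu⟩ : 𝒜 i) ⊗ₜ ⟨v * b, by simpa using SetLike.mul_mem_graded hv b.2⟩,
      Subtype.ext ?_⟩
    change u * (v * b) = (b : A)
    linear_combination (b : A) * huv

variable (φ : A →+* B) (hφ : ∀ (g : ι) (a : A), a ∈ 𝒜 g → φ a ∈ ℬ g)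

/-- The map `𝒜 g ⊗ ℬ 0 → ℬ g` is bijective if `𝒜 g` contains a unit. -/
theorem transferPiece_bijective {g : ι} {u : A} (hu : u ∈ 𝒜 g) (hunit : IsUnit u) :
    Function.Bijective (transferPiece 𝒜 ℬ φ hφ g) := by
  let := moduleB0 𝒜 ℬ φ hφ
  obtain ⟨v, hv, huv⟩ := exists_homogeneous_inverse 𝒜 hu hunit
  constructor
  · rw [injective_iff_map_eq_zero]
    intro t ht
    obtain ⟨y, rfl⟩ := TensorProduct.exists_eq_tmul_of_forall_eq_smul
      (exists_gradeZero_smul_eq 𝒜 ⟨u, hu⟩ hv huv) t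
    have hy : φ u * (y : B) = 0 := congrArg Subtype.val ht
    have : y = 0 := Subtype.ext ((hunit.map φ).mul_right_eq_zero.mp hy)
    rw [this, TensorProduct.tmul_zero]
  · intro b
    refine ⟨(⟨u, hu⟩ : 𝒜 g) ⊗ₜ
      ⟨φ v * b, by simpa using SetLike.mul_mem_graded (hφ _ v hv) b.2⟩, Subtype.ext ?_⟩
    have map_mul_inv : φ u * φ v = 1 := by rw [← map_mul, huv, map_one]
    change φ u * (φ v * b) = (b : B)
    linear_combination (b : B) * map_mul_inv

/-- A finite sum of homogeneous elements of distinct degrees vanishes only if each term does. -/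
theorem eq_zero_of_sum_homogeneous_eq_zero [Fintype ι] {x : ι → A} (hx : ∀ g, x g ∈ 𝒜 g)
    (h : ∑ g, x g = 0) (g : ι) : x g = 0 := by
  have key := congrArg (GradedRing.proj 𝒜 g) h
  rw [map_sum, map_zero, Finset.sum_eq_single g] at key
  · rwa [GradedRing.proj_apply, DirectSum.decompose_of_mem_same 𝒜 (hx g)] at key
  · intro k _ hk
    rw [GradedRing.proj_apply, DirectSum.decompose_of_mem_ne 𝒜 (hx k) hk]
  · simp

/-- The map `A ⊗ ℬ 0 → B` is bijective if every `𝒜 g` contains a unit. -/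
theorem transferTotal_bijective [Finite ι] (hunit : ∀ g : ι, ∃ a ∈ 𝒜 g, IsUnit a) :
    Function.Bijective (transferTotal 𝒜 ℬ φ hφ) := by
  classical
  let := moduleB0 𝒜 ℬ φ hφ
  cases nonempty_fintype ι
  choose u hu hunit using hunit
  choose v hv huv using fun g => exists_homogeneous_inverse 𝒜 (hu g) (hunit g)
  constructor
  · have sum_form : ∀ t : A ⊗[𝒜 0] ℬ 0, ∃ y : ι → ℬ 0, t = ∑ g, u g ⊗ₜ[𝒜 0] y g := by
      intro t
      induction t with
      | zero => exact ⟨0, by simp⟩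
      | tmul a b =>
        choose c hc using fun g =>
          exists_gradeZero_smul_eq 𝒜 ⟨u g, hu g⟩ (hv g) (huv g) (DirectSum.decompose 𝒜 a g)
        refine ⟨fun g => c g • b, ?_⟩
        have ha : a = ∑ g, c g • u g := by
          conv_lhs => rw [← DirectSum.sum_support_decompose 𝒜 a]
          rw [Finset.sum_subset (Finset.subset_univ _)]
          · exact Finset.sum_congr rfl fun g _ => congrArg Subtype.val (hc g)
          · intro g _ hg
            simpa using hg
        rw [ha, TensorProduct.sum_tmul]
        exact Finset.sum_congr rfl fun g _ => TensorProduct.smul_tmul _ _ _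
      | add s t hs ht =>
        obtain ⟨y, rfl⟩ := hs
        obtain ⟨z, rfl⟩ := ht
        exact ⟨y + z, by simp [TensorProduct.tmul_add, Finset.sum_add_distrib]⟩
    rw [injective_iff_map_eq_zero]
    intro t ht
    obtain ⟨y, rfl⟩ := sum_form t
    rw [map_sum] at ht
    have hzero := eq_zero_of_sum_homogeneous_eq_zero ℬ (x := fun g => φ (u g) * (y g : B))
      (fun g => by simpa using SetLike.mul_mem_graded (hφ g _ (hu g)) (y g).2) ht
    refine Finset.sum_eq_zero fun g _ => ?_
    have : y g = 0 := Subtype.ext (((hunit g).map φ).mul_right_eq_zero.mp (hzero g))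
    rw [this, TensorProduct.tmul_zero]
  · intro b
    rw [← AddMonoidHom.mem_range, ← DirectSum.sum_support_decompose ℬ b]
    refine AddSubgroup.sum_mem _ fun g _ => ?_
    obtain ⟨x, hx⟩ : ∃ x, x = DirectSum.decompose ℬ b g := ⟨_, rfl⟩
    rw [← hx]
    refine ⟨u g ⊗ₜ ⟨φ (v g) * x, by simpa using SetLike.mul_mem_graded (hφ _ _ (hv g)) x.2⟩, ?_⟩
    have map_mul_inv : φ (u g) * φ (v g) = 1 := by rw [← map_mul, huv, map_one]
    change φ (u g) * (φ (v g) * x) = (x : B)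
    linear_combination (x : B) * map_mul_inv

end HomogeneousUnits

/-- **Lemma 2.5.2** (affine form, with homogeneous unit bases).  Let `Γ` be a finite abelian
group and `φ : A → B` a homomorphism of `Γ`-graded commutative rings respecting the gradings.
Assume every `A_g` contains a unit of `A`.  Then (i) each multiplication map
`B_i ⊗_{B_0} B_j → B_{i+j}` is bijective; (ii) each map `A_g ⊗_{A_0} B_0 → B_g`,
`a ⊗ b ↦ φ(a)·b`, is bijective; (iii) the map `A ⊗_{A_0} B_0 → B`, `a ⊗ b ↦ φ(a)·b`, is
bijective. -/
theorem graded_hom_free_action_tensor_bijective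
    {Γ : Type*} [AddCommGroup Γ] [Finite Γ] [DecidableEq Γ]
    {A B : Type*} [CommRing A] [CommRing B]
    (𝒜 : Γ → AddSubgroup A) (ℬ : Γ → AddSubgroup B) [GradedRing 𝒜] [GradedRing ℬ]
    (φ : A →+* B) (hφ : ∀ (g : Γ) (a : A), a ∈ 𝒜 g → φ a ∈ ℬ g)
    (hunit : ∀ g : Γ, ∃ a ∈ 𝒜 g, IsUnit a) :
    (∀ i j : Γ, Function.Bijective (gradedMulMap ℬ i j)) ∧
    (∀ g : Γ, Function.Bijective (transferPiece 𝒜 ℬ φ hφ g)) ∧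
    Function.Bijective (transferTotal 𝒜 ℬ φ hφ) := by
  refine ⟨fun i j => ?_, fun g => ?_, transferTotal_bijective 𝒜 ℬ φ hφ hunit⟩
  · obtain ⟨a, ha, hu⟩ := hunit i
    exact gradedMulMap_bijective ℬ (hφ i a ha) (hu.map φ) j
  · obtain ⟨a, ha, hu⟩ := hunit g
    exact transferPiece_bijective 𝒜 ℬ φ hφ ha hu
end

section
/- Let p be a prime number and let A be a commutative ring equipped with a grading A = ⊕_{i∈ℤ/p} A_i by the group ℤ/p. Assume that for some m ≠ 0 in ℤ/p there exists an element of A_m that is a unit of A. Then for every i ∈ ℤ/p there exists an element of A_i that is a unit of A, and consequently for all i, j ∈ ℤ/p the multiplication map A_i ⊗_{A_0} A_j → A_{i+j} is bijective (where A_0 is a subring of A and each A_i is an A_0-module via multiplication). -/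
open scoped TensorProduct

section HomogeneousUnits

variable {ι : Type*} [AddCommGroup ι] [DecidableEq ι]
variable {A : Type*} [CommRing A]

/-- A homogeneous unit has a homogeneous inverse, of opposite degree. -/
theorem exists_mem_neg_mul_eq_one (𝒜 : ι → AddSubgroup A) [GradedRing 𝒜] {i : ι} {a : A}
    (ha : a ∈ 𝒜 i) (hu : IsUnit a) : ∃ b ∈ 𝒜 (-i), a * b = 1 := by
  obtain ⟨c, hc⟩ := hu.exists_right_inv
  refine ⟨DirectSum.decompose 𝒜 c (-i), SetLike.coe_mem _, ?_⟩
  rw [← DirectSum.coe_decompose_mul_add_of_left_mem 𝒜 ha, hc, add_neg_cancel]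
  exact DirectSum.decompose_of_mem_same 𝒜 SetLike.GradedOne.one_mem

@[simp]
theorem coe_gradedMulMap_tmul (𝒜 : ι → AddSubgroup A) [GradedRing 𝒜] {i j : ι}
    (x : 𝒜 i) (y : 𝒜 j) : (gradedMulMap 𝒜 i j (x ⊗ₜ[𝒜 0] y) : A) = x * y :=
  rfl

/-- If `a ∈ 𝒜 i` is a unit, then every tensor in `𝒜 i ⊗ M` is of the form `a ⊗ y`. -/
theorem exists_eq_tmul_of_isUnit (𝒜 : ι → AddSubgroup A) [GradedRing 𝒜] {i : ι}
    {M : Type*} [AddCommGroup M] [Module (𝒜 0) M]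
    (a : 𝒜 i) (hu : IsUnit (a : A)) (t : 𝒜 i ⊗[𝒜 0] M) :
    ∃ y : M, t = a ⊗ₜ[𝒜 0] y := by
  obtain ⟨b, hb, hab⟩ := exists_mem_neg_mul_eq_one 𝒜 a.2 hu
  induction t with
  | zero => exact ⟨0, (TensorProduct.tmul_zero _ _).symm⟩
  | add s t hs ht =>
    obtain ⟨y, rfl⟩ := hs
    obtain ⟨z, rfl⟩ := ht
    exact ⟨y + z, (TensorProduct.tmul_add _ _ _).symm⟩
  | tmul x y =>
    let c : 𝒜 0 := ⟨x * b, by simpa using SetLike.mul_mem_graded x.2 hb⟩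
    have hx : x = c • a := Subtype.ext <| by
      change (x : A) = x * b * a
      rw [mul_assoc, mul_comm b, hab, mul_one]
    exact ⟨c • y, by rw [hx, TensorProduct.smul_tmul]⟩

theorem gradedMulMap_bijective_of_isUnit (𝒜 : ι → AddSubgroup A) [GradedRing 𝒜] {i : ι}
    {a : A} (ha : a ∈ 𝒜 i) (hu : IsUnit a) (j : ι) :
    Function.Bijective (gradedMulMap 𝒜 i j) := by
  constructor
  · rw [injective_iff_map_eq_zero]
    intro t ht
    obtain ⟨y, rfl⟩ := exists_eq_tmul_of_isUnit 𝒜 ⟨a, ha⟩ hu t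
    have hy : a * (y : A) = 0 := congrArg Subtype.val ht
    have hy0 : y = 0 := Subtype.ext (hu.mul_right_eq_zero.mp hy)
    rw [hy0, TensorProduct.tmul_zero]
  · intro z
    obtain ⟨b, hb, hab⟩ := exists_mem_neg_mul_eq_one 𝒜 ha hu
    refine ⟨⟨a, ha⟩ ⊗ₜ ⟨b * z, by simpa using SetLike.mul_mem_graded hb z.2⟩, Subtype.ext ?_⟩
    rw [coe_gradedMulMap_tmul, ← mul_assoc, hab, one_mul]

end HomogeneousUnits

/-- **Lemma 2.6.6** (affine form).  Let `p` be a prime and `A` a commutative ring graded by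
`ℤ/p`.  If some `A_m` with `m ≠ 0` contains a unit of `A`, then every `A_i` contains a unit of
`A`, and consequently each multiplication map `A_i ⊗_{A_0} A_j → A_{i+j}` is bijective. -/
theorem exists_unit_in_every_degree_and_mulMap_bijective
    {p : ℕ} (hp : p.Prime) {A : Type*} [CommRing A]
    (𝒜 : ZMod p → AddSubgroup A) [GradedRing 𝒜]
    (h : ∃ m : ZMod p, m ≠ 0 ∧ ∃ a ∈ 𝒜 m, IsUnit a) :
    (∀ i : ZMod p, ∃ a ∈ 𝒜 i, IsUnit a) ∧
    (∀ i j : ZMod p, Function.Bijective (gradedMulMap 𝒜 i j)) := by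
  have hunit : ∀ i : ZMod p, ∃ a ∈ 𝒜 i, IsUnit a := by
    have : Fact p.Prime := ⟨hp⟩
    obtain ⟨m, hm, a, ha, hu⟩ := h
    intro i
    refine ⟨a ^ (i / m).val, ?_, hu.pow _⟩
    have hmem := SetLike.pow_mem_graded (i / m).val ha
    rwa [nsmul_eq_mul, ZMod.natCast_zmod_val, div_mul_cancel₀ i hm] at hmem
  refine ⟨hunit, fun i j => ?_⟩
  obtain ⟨a, ha, hu⟩ := hunit i
  exact gradedMulMap_bijective_of_isUnit 𝒜 ha hu j
end

section
/- Let p be a prime number, Γ a finite abelian p-group (a finite abelian group whose order is a power of p), k a field, and A a commutative k-algebra that is finite-dimensional as a k-vector space and is equipped with a Γ-grading A = ⊕_{g∈Γ} A_g by k-subspaces. If the ideal of A generated by all homogeneous elements of nonzero degree (i.e. by ⋃_{g≠0} A_g) is the whole ring A, then p divides dim_k A. -/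
open Module

/-- A natural-valued function on a finite abelian `p`-group that does not decrease under
translation by some nonzero element has sum divisible by `p`. -/
theorem prime_dvd_sum_of_le_add_left {p : ℕ} (hp : p.Prime) {Γ : Type*} [AddCommGroup Γ]
    [Fintype Γ] (hΓ : ∃ n : ℕ, Nat.card Γ = p ^ n) {g : Γ} (hg : g ≠ 0) (d : Γ → ℕ)
    (hd : ∀ x, d x ≤ d (g + x)) : p ∣ ∑ x, d x := by
  classical
  have hd_eq : ∀ x, d x = d (g + x) := by
    have hsum : ∑ x, d x = ∑ x, d (g + x) := (Equiv.sum_comp (Equiv.addLeft g) d).symm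
    intro x
    exact (Finset.sum_eq_sum_iff_of_le fun i _ => hd i).1 hsum x (Finset.mem_univ x)
  have hd_zsmul : ∀ (n : ℤ) (x : Γ), d (x + n • g) = d x := by
    intro n
    induction n with
    | zero => simp
    | succ n ih =>
      intro x
      rw [← ih x, hd_eq (x + (n : ℤ) • g), add_smul, one_smul]
      congr 1
      abel
    | pred n ih =>
      intro x
      rw [← ih x, hd_eq (x + (-(n : ℤ) - 1) • g), sub_smul, one_smul]
      congr 1
      abel
  have hfib : ∀ q : Γ ⧸ AddSubgroup.zmultiples g,
      ∀ s : AddSubgroup.zmultiples g, d (q.out + s) = d q.out := by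
    rintro q ⟨_, n, rfl⟩
    exact hd_zsmul n _
  let e : Γ ≃ (Γ ⧸ AddSubgroup.zmultiples g) × AddSubgroup.zmultiples g :=
    AddSubgroup.addGroupEquivQuotientProdAddSubgroup
  have hsymm : ∀ y, d (e.symm y) = d y.1.out := by
    intro y
    have hy : ((e.symm y : Γ) : Γ ⧸ AddSubgroup.zmultiples g) = y.1 :=
      congrArg Prod.fst (e.apply_symm_apply y)
    have hmem : -y.1.out + e.symm y ∈ AddSubgroup.zmultiples g := by
      rw [← QuotientAddGroup.eq, hy, QuotientAddGroup.out_eq']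
    have := hfib y.1 ⟨_, hmem⟩
    simpa using this
  have hcard : p ∣ Fintype.card (AddSubgroup.zmultiples g) := by
    rw [← Nat.card_eq_fintype_card, Nat.card_zmultiples]
    obtain ⟨n, hn⟩ := hΓ
    obtain ⟨m, -, hm⟩ := (Nat.dvd_prime_pow hp).1 (hn ▸ addOrderOf_dvd_natCard g)
    rw [hm]
    refine dvd_pow_self p ?_
    rintro rfl
    exact hg (AddMonoid.addOrderOf_eq_one_iff.1 (by simpa using hm))
  rw [← Equiv.sum_comp e.symm d]
  simp_rw [hsymm]
  rw [Fintype.sum_prod_type]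
  refine Finset.dvd_sum fun q _ => ?_
  simpa using hcard.mul_right _

/-- Rank-nullity for the restriction of an endomorphism to a subspace. -/
theorem finrank_inf_ker_add_finrank_map {k V : Type*} [Field k] [AddCommGroup V] [Module k V]
    [FiniteDimensional k V] (f : V →ₗ[k] V) (N : Submodule k V) :
    finrank k ↥(N ⊓ LinearMap.ker f) + finrank k (N.map f) = finrank k N := by
  rw [← LinearMap.finrank_range_add_finrank_ker (f.domRestrict N), add_comm,
    LinearMap.range_domRestrict, LinearMap.ker_domRestrict,
    ← Submodule.map_comap_subtype, Submodule.finrank_map_subtype_eq]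

/-- Let the homogeneous elements of nonzero degree generate the unit ideal of `A`. Then the total
dimension of any `Γ`-indexed family of subspaces of `A` on which multiplication by homogeneous
elements shifts the index by the degree is divisible by `p`. -/
theorem prime_dvd_sum_finrank {p : ℕ} (hp : p.Prime)
    {Γ : Type*} [AddCommGroup Γ] [Fintype Γ] (hΓ : ∃ n : ℕ, Nat.card Γ = p ^ n)
    {k : Type*} [Field k] {A : Type*} [CommRing A] [Algebra k A] [FiniteDimensional k A]
    (𝒜 : Γ → Submodule k A)
    (h : Ideal.span {x : A | ∃ g : Γ, g ≠ 0 ∧ x ∈ 𝒜 g} = ⊤)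
    (N : Γ → Submodule k A)
    (hN : ∀ g i, ∀ a ∈ 𝒜 g, ∀ y ∈ N i, a * y ∈ N (g + i)) :
    p ∣ ∑ i, finrank k (N i) := by
  induction hs : ∑ i, finrank k (N i) using Nat.strong_induction_on generalizing N with
  | _ s ih =>
  subst hs
  by_cases hnil : ∀ g ≠ 0, ∀ a ∈ 𝒜 g, ∀ i, ∀ y ∈ N i, a ^ finrank k A * y = 0
  · let J : Ideal A := Submodule.annihilator (Submodule.span A (⋃ i, (N i : Set A)))
    have hJ : ∀ x, x ∈ J ↔ ∀ i, ∀ y ∈ N i, x * y = 0 := by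
      intro x
      simp only [J, Submodule.mem_annihilator_span, Subtype.forall, Set.mem_iUnion,
        SetLike.mem_coe, smul_eq_mul]
      exact ⟨fun H i y hy => H y ⟨i, hy⟩, fun H y ⟨i, hy⟩ => H i y hy⟩
    have hrad : J.radical = ⊤ := by
      rw [eq_top_iff, ← h, Ideal.span_le]
      rintro a ⟨g, hg, ha⟩
      exact ⟨finrank k A, (hJ _).2 (hnil g hg a ha)⟩
    have hone : (1 : A) ∈ J := (Ideal.eq_top_iff_one J).1 (Ideal.radical_eq_top.1 hrad)
    have hbot : ∀ i, N i = ⊥ := fun i =>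
      (Submodule.eq_bot_iff _).2 fun y hy => by simpa using (hJ 1).1 hone i y hy
    exact Finset.dvd_sum fun i _ => by rw [hbot i, finrank_bot]; exact dvd_zero p
  · push Not at hnil
    obtain ⟨g, hg, a, ha, i, y, hy, hay⟩ := hnil
    let f : A →ₗ[k] A := LinearMap.mulLeft k (a ^ finrank k A)
    have hf : ∀ x, f x = a ^ finrank k A * x := fun _ => rfl
    have hinj : ∀ x, a * (a ^ finrank k A * x) = 0 → a ^ finrank k A * x = 0 := by
      intro x hx
      have hker := Module.End.ker_pow_eq_ker_pow_finrank_of_le (f := LinearMap.mulLeft k a)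
        (Nat.le_succ (finrank k A))
      have hx' : x ∈ LinearMap.ker (LinearMap.mulLeft k a ^ (finrank k A).succ) := by
        rw [LinearMap.pow_mulLeft, LinearMap.mem_ker, LinearMap.mulLeft_apply, pow_succ',
          mul_assoc, hx]
      rwa [hker, LinearMap.pow_mulLeft, LinearMap.mem_ker, LinearMap.mulLeft_apply] at hx'
    have hmap : p ∣ ∑ j, finrank k ((N j).map f) := by
      refine prime_dvd_sum_of_le_add_left hp hΓ hg _ fun j => ?_
      have hmaps : ∀ z ∈ (N j).map f, LinearMap.mulLeft k a z ∈ (N (g + j)).map f := by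
        rintro _ ⟨x, hx, rfl⟩
        refine ⟨a * x, hN g j a ha x hx, ?_⟩
        rw [hf, hf, LinearMap.mulLeft_apply, mul_left_comm]
      refine LinearMap.finrank_le_finrank_of_injective
        (f := (LinearMap.mulLeft k a).restrict hmaps) ?_
      rw [← LinearMap.ker_eq_bot, LinearMap.ker_eq_bot']
      rintro ⟨_, x, hx, rfl⟩ hz
      exact Subtype.ext (hinj x (congrArg Subtype.val hz))
    have hsum : ∑ j, finrank k ↥(N j ⊓ LinearMap.ker f) + ∑ j, finrank k ((N j).map f) =
        ∑ j, finrank k (N j) := by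
      rw [← Finset.sum_add_distrib]
      exact Finset.sum_congr rfl fun j _ => finrank_inf_ker_add_finrank_map f (N j)
    have hpos : 0 < ∑ j, finrank k ((N j).map f) := by
      refine Finset.sum_pos' (fun _ _ => Nat.zero_le _) ⟨i, Finset.mem_univ i, ?_⟩
      exact Module.finrank_pos_iff_exists_ne_zero.2
        ⟨⟨f y, Submodule.mem_map_of_mem hy⟩, fun h0 => hay (congrArg Subtype.val h0)⟩
    rw [← hsum]
    refine dvd_add (ih _ (by lia) (fun j => N j ⊓ LinearMap.ker f) ?_ rfl) hmap
    rintro g' j b hb x ⟨hx, hxf⟩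
    refine ⟨hN g' j b hb x hx, ?_⟩
    rw [SetLike.mem_coe, LinearMap.mem_ker, hf] at hxf ⊢
    rw [mul_left_comm, hxf, mul_zero]


/-- **Lemma 5.2.6** (affine form).  Let `p` be a prime, `Γ` a finite abelian `p`-group, `k` a
field, and `A` a finite-dimensional commutative `k`-algebra with a `Γ`-grading by
`k`-subspaces.  If the ideal generated by all homogeneous elements of nonzero degree is the
whole ring, then `p` divides `dim_k A`. -/
theorem prime_dvd_finrank_of_irrelevant_ideal_eq_top
    {p : ℕ} (hp : p.Prime)
    {Γ : Type*} [AddCommGroup Γ] [Finite Γ] [DecidableEq Γ]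
    (hΓ : ∃ n : ℕ, Nat.card Γ = p ^ n)
    {k : Type*} [Field k] {A : Type*} [CommRing A] [Algebra k A]
    [FiniteDimensional k A]
    (𝒜 : Γ → Submodule k A) [GradedAlgebra 𝒜]
    (h : Ideal.span {x : A | ∃ g : Γ, g ≠ 0 ∧ x ∈ 𝒜 g} = ⊤) :
    p ∣ Module.finrank k A := by
  have := Fintype.ofFinite Γ
  have hdim : finrank k A = ∑ i, finrank k (𝒜 i) := by
    rw [(DirectSum.decomposeLinearEquiv 𝒜).finrank_eq, Module.finrank_directSum]
  rw [hdim]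
  exact prime_dvd_sum_finrank hp hΓ 𝒜 h 𝒜 fun _ _ _ ha _ hy => SetLike.mul_mem_graded ha hy
end

section
/- Let G be a group acting on a Noetherian topological space X such that for every g ∈ G the map x ↦ g • x is a homeomorphism. Call a subset S ⊆ X G-invariant if g • S = S for all g ∈ G, and call a nonempty closed G-invariant subset Y ⊆ X G-irreducible if every G-invariant open subset of X that meets Y has dense intersection with Y. Then every closed G-invariant subset of X is a finite union of G-irreducible closed G-invariant subsets. -/
open scoped Pointwise

/-- If `x ↦ g • x` is a homeomorphism, then `g • ·` commutes with closure of sets. -/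
theorem smul_set_closure_of_isHomeomorph {G X : Type*} [TopologicalSpace X] [SMul G X] {g : G}
    (hg : IsHomeomorph (fun x : X => g • x)) (S : Set X) :
    g • closure S = closure (g • S) :=
  hg.homeomorph.image_closure S

/-- **Lemma 5.1.3** (topological content). Let a group `G` act by homeomorphisms on a
Noetherian topological space `X`.  Call a subset `S` `G`-invariant if `g • S = S` for all `g`,
and call a nonempty closed `G`-invariant subset `Y` `G`-irreducible if every `G`-invariant open
subset of `X` meeting `Y` has dense intersection with `Y`.  Then every closed `G`-invariant
subset of `X` is a finite union of `G`-irreducible closed `G`-invariant subsets. -/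
theorem closed_invariant_eq_finite_union_of_G_irreducible
    {G X : Type*} [Group G] [TopologicalSpace X] [TopologicalSpace.NoetherianSpace X]
    [MulAction G X] (hG : ∀ g : G, IsHomeomorph (fun x : X => g • x))
    (Z : Set X) (hZclosed : IsClosed Z) (hZinv : ∀ g : G, g • Z = Z) :
    ∃ 𝒮 : Finset (Set X), Z = ⋃₀ ↑𝒮 ∧
      ∀ Y ∈ 𝒮, Y.Nonempty ∧ IsClosed Y ∧ (∀ g : G, g • Y = Y) ∧
        (∀ U : Set X, IsOpen U → (∀ g : G, g • U = U) → (U ∩ Y).Nonempty →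
          Y ⊆ closure (U ∩ Y)) := by
  classical
  lift Z to TopologicalSpace.Closeds X using hZclosed
  induction Z using WellFoundedLT.induction with
  | ind Z ih =>
  by_cases hne : (Z : Set X).Nonempty
  swap
  · exact ⟨∅, by simpa [Set.not_nonempty_iff_eq_empty] using hne, by simp⟩
  by_cases hirr : ∀ U : Set X, IsOpen U → (∀ g : G, g • U = U) → (U ∩ Z).Nonempty →
      (Z : Set X) ⊆ closure (U ∩ Z)
  · refine ⟨{(Z : Set X)}, by simp, fun Y hY => ?_⟩
    obtain rfl := Finset.mem_singleton.mp hY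
    exact ⟨hne, Z.isClosed, hZinv, hirr⟩
  push Not at hirr
  obtain ⟨U, hU, hUinv, ⟨x, hxU, hxZ⟩, hUZ⟩ := hirr
  have hsub : closure (U ∩ Z) ⊆ (Z : Set X) := closure_minimal Set.inter_subset_right Z.isClosed
  obtain ⟨𝒜, h𝒜, h𝒜irr⟩ := ih ⟨closure (U ∩ Z), isClosed_closure⟩
    (SetLike.coe_ssubset_coe.mp ⟨hsub, hUZ⟩) fun g => by
      simp [smul_set_closure_of_isHomeomorph (hG g), Set.smul_set_inter, hUinv, hZinv]
  obtain ⟨ℬ, hℬ, hℬirr⟩ := ih ⟨Z \ U, Z.isClosed.sdiff hU⟩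
    (SetLike.coe_ssubset_coe.mp ⟨Set.sdiff_subset, fun h => (h hxZ).2 hxU⟩) fun g => by
      simp [Set.smul_set_sdiff, hUinv, hZinv]
  refine ⟨𝒜 ∪ ℬ, ?_, fun Y hY => (Finset.mem_union.mp hY).elim (h𝒜irr Y) (hℬirr Y)⟩
  rw [Finset.coe_union, Set.sUnion_union, ← h𝒜, ← hℬ]
  refine Set.Subset.antisymm (fun y hy => ?_) (Set.union_subset hsub Set.sdiff_subset)
  by_cases hyU : y ∈ U
  · exact Or.inl (subset_closure ⟨hyU, hy⟩)
  · exact Or.inr ⟨hy, hyU⟩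
end
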